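/- arXiv:1102.5730 — 4 statements merged into one kernel-verified Lean document; each statement's English description precedes it below -/
import Mathlib

section
/- For every integer k ≥ 1, the polynomial 3X^{2k} − 7X^k + 3 is irreducible in ℚ[X]. -/
open Polynomial

namespace Polynomial

theorem reverse_reverse_of_coeff_zero_ne_zero {R : Type*} [Semiring R] {f : R[X]}
    (h0 : f.coeff 0 ≠ 0) : f.reverse.reverse = f := by
  have ht : f.natTrailingDegree = 0 := natTrailingDegree_eq_zero.2 (Or.inr h0)
  have hd : f.reverse.natDegree = f.natDegree := by rw [reverse_natDegree, ht, Nat.sub_zero]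
  ext n
  rw [coeff_reverse, coeff_reverse, hd, revAt_invol]

theorem isUnit_of_isUnit_reverse {K : Type*} [Field K] {f : K[X]} (h0 : f.coeff 0 ≠ 0)
    (hf : IsUnit f.reverse) : IsUnit f := by
  obtain ⟨c, hc, hcf⟩ := isUnit_iff.1 hf
  rw [← reverse_reverse_of_coeff_zero_ne_zero h0, ← hcf, reverse_C]
  exact isUnit_C.2 hc

theorem irreducible_reverse {K : Type*} [Field K] {f : K[X]} (h0 : f.coeff 0 ≠ 0)
    (hf : Irreducible f) : Irreducible f.reverse := by
  have hr := reverse_reverse_of_coeff_zero_ne_zero h0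
  have hr0 : f.reverse.coeff 0 ≠ 0 := by
    rw [coeff_zero_reverse]
    exact leadingCoeff_ne_zero.2 hf.ne_zero
  refine ⟨fun h => hf.not_isUnit (isUnit_of_isUnit_reverse h0 h), fun a b hab => ?_⟩
  have hab0 := hr0
  rw [hab, mul_coeff_zero] at hab0
  rw [hab, reverse_mul_of_domain] at hr
  exact (hf.isUnit_or_isUnit hr.symm).imp
    (isUnit_of_isUnit_reverse (left_ne_zero_of_mul hab0))
    (isUnit_of_isUnit_reverse (right_ne_zero_of_mul hab0))

/-- If `F` splits over an extension as a product of two irreducible factors, one of which is not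
associated to a polynomial over the base field, then `F` is irreducible. -/
theorem irreducible_of_map_eq_mul {K L : Type*} [Field K] [Field L] (i : K →+* L) {F : K[X]}
    {P Q : L[X]} (hP : Irreducible P) (hQ : Irreducible Q) (hF : F.map i = P * Q)
    (hnP : ∀ f : K[X], ¬ Associated P (f.map i)) : Irreducible F := by
  have key : ∀ f g : K[X], F = f * g → P ∣ f.map i → IsUnit g := by
    rintro f g rfl ⟨h, hh⟩
    rw [Polynomial.map_mul, hh, mul_assoc] at hF
    rcases hQ.isUnit_or_isUnit (mul_left_cancel₀ hP.ne_zero hF).symm with hu | hu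
    · exact absurd (hh ▸ associated_mul_unit_right P h hu) (hnP f)
    · exact (isUnit_map i).1 hu
  refine ⟨fun h => ?_, fun f g hfg => ?_⟩
  · have h' := (isUnit_map i).2 h
    rw [hF] at h'
    exact hP.not_isUnit (isUnit_of_mul_isUnit_left h')
  · have hd : P ∣ f.map i * g.map i := ⟨Q, by rw [← Polynomial.map_mul, ← hfg, hF]⟩
    rcases hP.prime.dvd_or_dvd hd with hd | hd
    · exact Or.inr (key f g hfg hd)
    · exact Or.inl (key g f (hfg.trans (mul_comm f g)) hd)

/-- `X ^ k - a` is irreducible over the fraction field of an integrally closed domain containing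
`a` if `a` lies in a prime ideal but not in its square. -/
theorem irreducible_X_pow_sub_C_algebraMap {R K : Type*} [CommRing R] [IsDomain R]
    [IsIntegrallyClosed R] [Field K] [Algebra R K] [IsFractionRing R K] {I : Ideal R}
    (hI : I.IsPrime) {a : R} (ha : a ∈ I) (ha2 : a ∉ I ^ 2) {k : ℕ} (hk : k ≠ 0) :
    Irreducible (X ^ k - C (algebraMap R K a)) := by
  have hm : (X ^ k - C a : R[X]).Monic := monic_X_pow_sub_C a hk
  have hirr : Irreducible (X ^ k - C a : R[X]) := by
    refine IsEisensteinAt.irreducible (𝓟 := I) ⟨?_, ?_, ?_⟩ hI hm.isPrimitive ?_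
    · rw [hm.leadingCoeff]
      exact fun h => hI.ne_top ((Ideal.eq_top_iff_one I).2 h)
    · intro n hn
      rw [natDegree_X_pow_sub_C] at hn
      rw [coeff_sub, coeff_X_pow, if_neg hn.ne, coeff_C, zero_sub, neg_mem_iff]
      split_ifs
      · exact ha
      · exact I.zero_mem
    · simpa [coeff_X_pow, hk.symm] using ha2
    · rw [natDegree_X_pow_sub_C]
      exact hk.bot_lt
  simpa using (hm.irreducible_iff_irreducible_map_fraction_map (K := K)).1 hirr

end Polynomial

theorem exists_padicInt_root :
    ∃ z : ℤ_[3], 3 * z ^ 2 - 7 * z + 3 = 0 ∧ (3 : ℤ_[3]) ∣ z ∧ ¬ (3 : ℤ_[3]) ^ 2 ∣ z := by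
  have h7 : ‖(7 : ℤ_[3])‖ = 1 := by
    exact_mod_cast (PadicInt.norm_natCast_eq_one_iff (p := 3) (n := 7)).2 (by norm_num)
  have h3 : ‖(3 : ℤ_[3])‖ < 1 := by
    exact_mod_cast (PadicInt.norm_lt_one_iff_dvd (p := 3) (3 : ℤ_[3])).2 (by simp)
  obtain ⟨z, hz, hz0, -⟩ := hensels_lemma (p := 3) (R := ℤ_[3])
    (F := C 3 * X ^ 2 - C 7 * X + C 3) (a := 0) (by simpa [h7] using h3)
  have hz' : 3 * z ^ 2 - 7 * z + 3 = 0 := by simpa using hz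
  have hz1 : ‖z‖ < 1 := by simpa [h7] using hz0
  refine ⟨z, hz', by exact_mod_cast (PadicInt.norm_lt_one_iff_dvd z).1 hz1, ?_⟩
  rintro ⟨w, rfl⟩
  have hu : (3 : ℤ_[3]) * (7 * w - 27 * w ^ 2) = 1 := by
    have h30 : (3 : ℤ_[3]) ≠ 0 := by norm_num
    apply mul_left_cancel₀ h30
    linear_combination -hz'
  exact h3.ne (PadicInt.isUnit_iff.1 (IsUnit.of_mul_eq_one _ hu))

theorem rat_three_mul_sq_sub_seven_mul_add_three_ne_zero (q : ℚ) : 3 * q ^ 2 - 7 * q + 3 ≠ 0 := by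
  intro h
  have hs : ¬ IsSquare (13 : ℚ) := by norm_num
  exact hs ⟨6 * q - 7, by linear_combination -12 * h⟩

/-- For every integer `k ≥ 1`, the polynomial `3X^(2k) - 7X^k + 3` is irreducible in `ℚ[X]`. -/
theorem irreducible_three_sub_seven_pow (k : ℕ) (hk : 1 ≤ k) :
    Irreducible (3 * X ^ (2 * k) - 7 * X ^ k + 3 : ℚ[X]) := by
  have hk0 : k ≠ 0 := Nat.one_le_iff_ne_zero.1 hk
  obtain ⟨z, hz, h3, h9⟩ := exists_padicInt_root
  set a : ℚ_[3] := algebraMap ℤ_[3] ℚ_[3] z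
  have ha : 3 * a ^ 2 - 7 * a + 3 = 0 := by
    have h := congrArg (algebraMap ℤ_[3] ℚ_[3]) hz
    simpa only [map_add, map_sub, map_mul, map_pow, map_ofNat, map_zero] using h
  have ha0 : a ≠ 0 := by
    intro h
    norm_num [h] at ha
  have hP : Irreducible (X ^ k - C a) := by
    refine irreducible_X_pow_sub_C_algebraMap (I := Ideal.span {(3 : ℤ_[3])}) ?_
      (Ideal.mem_span_singleton.2 h3) ?_ hk0
    · rw [Ideal.span_singleton_prime (by norm_num)]
      exact_mod_cast PadicInt.prime_p (p := 3)
    · rwa [Ideal.span_singleton_pow, Ideal.mem_span_singleton]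
  have hP0 : (X ^ k - C a).coeff 0 = -a := by simp [coeff_X_pow, hk0.symm]
  have hrev : (X ^ k - C a).reverse = 1 - C a * X ^ k := by
    rw [reverse, natDegree_X_pow_sub_C, reflect_sub, reflect_monomial, reflect_C,
      revAt_le le_rfl, Nat.sub_self, pow_zero]
  have hQ : Irreducible (C (-3 / a) * (X ^ k - C a).reverse) :=
    (irreducible_isUnit_mul (isUnit_C.2 (by simpa using ha0))).2
      (irreducible_reverse (by simpa [hP0] using ha0) hP)
  refine irreducible_of_map_eq_mul (algebraMap ℚ ℚ_[3]) hP hQ ?_ ?_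
  · have hc1 : -3 / a * a = -3 := div_mul_cancel₀ _ ha0
    have hc2 : -3 / a * (1 + a ^ 2) = -7 := by
      field_simp
      linear_combination -ha
    have hC1 := congrArg (C : ℚ_[3] → ℚ_[3][X]) hc1
    have hC2 := congrArg (C : ℚ_[3] → ℚ_[3][X]) hc2
    simp only [C_mul, C_add, C_pow, C_neg, C_1, map_ofNat] at hC1 hC2
    rw [hrev]
    simp only [Polynomial.map_add, Polynomial.map_sub, Polynomial.map_mul, Polynomial.map_pow,
      map_X, Polynomial.map_ofNat, pow_mul' X 2 k]
    linear_combination (X ^ k * X ^ k + 1) * hC1 - X ^ k * hC2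
  · rintro f ⟨u, hu⟩
    obtain ⟨c, hc, hcu⟩ := isUnit_iff.1 u.isUnit
    rw [← hcu] at hu
    have h0 := congrArg (fun p => coeff p 0) hu
    have hl := congrArg (fun p => coeff p k) hu
    simp only [coeff_mul_C, coeff_map, hP0] at h0
    have hPk : (X ^ k - C a).coeff k = 1 := by simp [coeff_C, hk0]
    simp only [coeff_mul_C, coeff_map, hPk, one_mul] at hl
    apply rat_three_mul_sq_sub_seven_mul_add_three_ne_zero (-f.coeff 0 / f.coeff k)
    apply (algebraMap ℚ ℚ_[3]).injective
    have hq : algebraMap ℚ ℚ_[3] (-f.coeff 0 / f.coeff k) = a := by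
      rw [map_div₀, map_neg, ← h0, ← hl, neg_mul, neg_neg, mul_div_cancel_right₀ _ hc.ne_zero]
    rw [map_zero, map_add, map_sub, map_mul, map_mul, map_pow, hq]
    simpa using ha
end

section
/- For every integer k ≥ 1, the element 3T^{2k} − 7T^k + 3 of the Laurent polynomial ring ℤ[T,T⁻¹] is irreducible. -/
open LaurentPolynomial

namespace Polynomial

theorem isUnit_of_dvd_of_forall_isIntegral_aeval_ne_zero {p a : ℤ[X]}
    (ha : IsUnit a.leadingCoeff) (hdvd : a ∣ p)
    (hp : ∀ z : ℂ, IsIntegral ℤ z → aeval z p ≠ 0) : IsUnit a := by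
  wlog hm : a.Monic generalizing a
  · have h := Int.isUnit_iff.1 ha
    rcases h with h | h
    · exact this ha hdvd h
    · have : IsUnit (-a) := this (by simp [h]) (neg_dvd.2 hdvd) (by simp [Monic, h])
      exact (IsUnit.neg_iff a).1 this
  by_contra hu
  have hdeg : a.natDegree ≠ 0 := fun h => hu (by simp [hm.natDegree_eq_zero.1 h])
  obtain ⟨z, hz⟩ := IsAlgClosed.exists_aeval_eq_zero ℂ a
    (fun h => hdeg (natDegree_eq_of_degree_eq_some h))
  obtain ⟨b, rfl⟩ := hdvd
  exact hp z ⟨a, hm, by simpa [aeval_def] using hz⟩ (by simp [hz])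

theorem not_isIntegral_of_three_mul_sq_sub {z : ℂ} (hz : 3 * z ^ 2 - 7 * z + 3 = 0) :
    ¬ IsIntegral ℤ z := by
  intro hi
  obtain ⟨q, hq⟩ : minpoly ℤ z ∣ (3 * X ^ 2 - 7 * X + 3 : ℤ[X]) :=
    minpoly.isIntegrallyClosed_dvd hi (by simpa [map_ofNat] using hz)
  have hm := minpoly.monic hi
  have hpos := minpoly.natDegree_pos hi
  set m := minpoly ℤ z
  have hmap := congrArg (map (Int.castRingHom (ZMod 3))) hq
  have h3 : (3 : (ZMod 3)[X]) = 0 := CharP.cast_eq_zero (ZMod 3)[X] 3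
  have h7 : (7 : (ZMod 3)[X]) = 1 := by linear_combination 2 * h3
  simp only [Polynomial.map_mul, Polynomial.map_add, Polynomial.map_sub, Polynomial.map_ofNat,
    Polynomial.map_pow, map_X, h3, h7, zero_mul, one_mul, zero_sub, add_zero] at hmap
  have hd := natDegree_le_of_dvd (Dvd.intro _ hmap.symm) (neg_ne_zero.2 X_ne_zero)
  rw [hm.natDegree_map, natDegree_neg, natDegree_X] at hd
  have hX := hm.eq_X_add_C (by omega)
  have he := congrArg (eval (-m.coeff 0)) hq
  rw [eval_mul, hX] at he
  simp only [eval_add, eval_sub, eval_mul, eval_pow, eval_X, eval_ofNat, eval_C, coeff_add,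
    coeff_X_zero, coeff_C_zero, zero_add, neg_add_cancel, zero_mul] at he
  have h2 := congrArg (Int.cast : ℤ → ZMod 2) he
  push_cast at h2
  generalize ((m.coeff 0 : ℤ) : ZMod 2) = c at h2
  revert h2 c
  decide

theorem natDegree_three_sub_seven_pow {n : ℕ} (hn : n ≠ 0) :
    (3 * X ^ (2 * n) - 7 * X ^ n + 3 : ℤ[X]).natDegree = 2 * n := by
  have : (3 * X ^ (2 * n) - 7 * X ^ n + 3 : ℤ[X]) =
    C 3 * X ^ (2 * n) - C 7 * X ^ n + C 3 := by simp
  rw [this]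
  compute_degree!
  all_goals grind

theorem leadingCoeff_three_sub_seven_pow {n : ℕ} (hn : n ≠ 0) :
    (3 * X ^ (2 * n) - 7 * X ^ n + 3 : ℤ[X]).leadingCoeff = 3 := by
  have : (3 * X ^ (2 * n) - 7 * X ^ n + 3 : ℤ[X]) =
    C 3 * X ^ (2 * n) - C 7 * X ^ n + C 3 := by simp
  rw [leadingCoeff, natDegree_three_sub_seven_pow hn, this]
  simp only [coeff_add, coeff_sub, coeff_C_mul, coeff_X_pow, coeff_C]
  grind

theorem irreducible_three_sub_seven_pow {n : ℕ} (hn : n ≠ 0) :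
    Irreducible (3 * X ^ (2 * n) - 7 * X ^ n + 3 : ℤ[X]) := by
  have hroot : ∀ z : ℂ, IsIntegral ℤ z →
      aeval z (3 * X ^ (2 * n) - 7 * X ^ n + 3 : ℤ[X]) ≠ 0 := fun z hz h =>
    not_isIntegral_of_three_mul_sq_sub (z := z ^ n)
      (by simpa [← pow_mul, mul_comm n 2, map_ofNat] using h) (hz.pow n)
  refine ⟨fun hu => ?_, fun a b hab => ?_⟩
  · have := natDegree_eq_zero_of_isUnit hu
    rw [natDegree_three_sub_seven_pow hn] at this
    omega
  · have hl := leadingCoeff_three_sub_seven_pow hn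
    rw [hab, leadingCoeff_mul] at hl
    refine (Int.prime_three.irreducible.isUnit_or_isUnit hl.symm).imp (fun h => ?_) fun h => ?_
    · exact isUnit_of_dvd_of_forall_isIntegral_aeval_ne_zero h ⟨b, hab⟩ hroot
    · exact isUnit_of_dvd_of_forall_isIntegral_aeval_ne_zero h
        ⟨a, hab.trans (mul_comm a b)⟩ hroot

theorem _root_.Prime.toLaurent {R : Type*} [CommRing R] [IsDomain R] {p : R[X]} (hp : Prime p)
    (hX : ¬ p ∣ X) : Prime (toLaurent p) := by
  have h := IsLocalization.isPrime_of_isPrime_disjoint (Submonoid.powers (X : R[X])) R[T;T⁻¹]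
    (Ideal.span {p}) ((Ideal.span_singleton_prime hp.ne_zero).2 hp) (by
      rw [Set.disjoint_left]
      rintro _ ⟨m, rfl⟩ h
      exact hX (hp.dvd_of_dvd_pow (Ideal.mem_span_singleton.1 h)))
  rw [Ideal.map_span, Set.image_singleton, algebraMap_eq_toLaurent] at h
  exact (Ideal.span_singleton_prime (toLaurent_ne_zero.2 hp.ne_zero)).1 h

end Polynomial

/-- For every integer `k ≥ 1`, the Laurent polynomial `3T^(2k) - 7T^k + 3` is
irreducible in `ℤ[T,T⁻¹]`. -/
theorem irreducible_laurent_three_sub_seven_pow (k : ℤ) (hk : 1 ≤ k) :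
    Irreducible (3 * T (2 * k) - 7 * T k + 3 : LaurentPolynomial ℤ) := by
  lift k to ℕ using by omega
  have hn : k ≠ 0 := by omega
  have h := (Polynomial.irreducible_three_sub_seven_pow hn).prime.toLaurent fun h => by
    have := Polynomial.natDegree_le_of_dvd h Polynomial.X_ne_zero
    rw [Polynomial.natDegree_three_sub_seven_pow hn, Polynomial.natDegree_X] at this
    omega
  simpa [map_ofNat] using h.irreducible
end

section
/- Let R be a commutative unique factorization domain and let φ : R → R be a ring automorphism. Suppose a and b are irreducible elements of R that are not associated to each other, φ(a) is associated to a, and φ(b) is associated to b. Then a·b is not associated to f·φ(f) for any element f of R. -/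
/-- In a commutative UFD `R` with a ring automorphism `φ`, if `a` and `b` are
non-associated irreducibles, each associated to its own image under `φ`, then
`a * b` is not associated to `f * φ f` for any `f : R`. -/
theorem not_associated_mul_map_of_irreducible
    {R : Type*} [CommRing R] [IsDomain R] [UniqueFactorizationMonoid R]
    (φ : R ≃+* R) (a b : R) (ha : Irreducible a) (hb : Irreducible b)
    (hab : ¬ Associated a b) (hφa : Associated (φ a) a) (hφb : Associated (φ b) b) :
    ∀ f : R, ¬ Associated (a * b) (f * φ f) := by
  intro f hf
  have hmap : a ∣ φ f ↔ a ∣ f := by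
    rw [← hφa.dvd_iff_dvd_left, map_dvd_iff]
  have hdvd : a ∣ f * φ f := (dvd_mul_right a b).trans hf.dvd
  have haf : a ∣ f := (ha.prime.dvd_or_dvd hdvd).elim id hmap.1
  have hsq : a * a ∣ a * b := (mul_dvd_mul haf (hmap.2 haf)).trans hf.symm.dvd
  exact hab (ha.associated_of_dvd hb ((mul_dvd_mul_iff_left ha.ne_zero).1 hsq))
end

section
/- For all integers k ≥ 1 and p ≥ 2, there is no Laurent polynomial f ∈ ℤ[T,T⁻¹] such that (3T^{2k} − 7T^k + 3)·(3T^{2kp} − 7T^{kp} + 3) is associated (i.e., equal up to multiplication by a unit ±T^g of ℤ[T,T⁻¹]) to f·invert(f), where invert denotes the ring automorphism of ℤ[T,T⁻¹] sending T to T⁻¹. -/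
open LaurentPolynomial

namespace Polynomial

section Laurent

variable {R : Type*} [CommRing R] {P : R[X]}

/-- Divisibility by a prime other than `X` descends from Laurent polynomials to polynomials. -/
theorem dvd_of_toLaurent_dvd (hP : Prime P) (hX : ¬ P ∣ X) {Q : R[X]}
    (h : toLaurent P ∣ toLaurent Q) : P ∣ Q := by
  obtain ⟨c, hc⟩ := h
  obtain ⟨n, c', hc'⟩ := LaurentPolynomial.exists_T_pow c
  have key : Q * X ^ n = P * c' := by
    apply toLaurent_injective
    rw [map_mul, map_mul, hc', hc, toLaurent_X_pow, mul_assoc]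
  exact (hP.dvd_or_dvd (Dvd.intro c' key.symm)).resolve_right fun hn =>
    hX (hP.dvd_of_dvd_pow hn)

/-- A prime polynomial other than `X` stays prime among Laurent polynomials. -/
theorem prime_toLaurent [IsDomain R] (hP : Prime P) (hX : ¬ P ∣ X) : Prime (toLaurent P) := by
  refine ⟨toLaurent_ne_zero.2 hP.ne_zero, fun hu => ?_, fun f g h => ?_⟩
  · exact hP.not_isUnit <| isUnit_of_dvd_one <| dvd_of_toLaurent_dvd hP hX <| by
      simpa using hu.dvd
  · obtain ⟨m, f', hf⟩ := LaurentPolynomial.exists_T_pow f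
    obtain ⟨n, g', hg⟩ := LaurentPolynomial.exists_T_pow g
    have hfg : P ∣ f' * g' := by
      refine dvd_of_toLaurent_dvd hP hX ?_
      rw [map_mul, hf, hg, mul_mul_mul_comm]
      exact h.mul_right _
    have descend {a : R[T;T⁻¹]} {a' : R[X]} {l : ℕ} (ha : toLaurent a' = a * T l)
        (hd : P ∣ a') : toLaurent P ∣ a := by
      rw [← (isUnit_T (l : ℤ)).dvd_mul_right, ← ha]
      exact _root_.map_dvd toLaurent hd
    exact (hP.dvd_or_dvd hfg).imp (descend hf) (descend hg)

end Laurent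

end Polynomial

/-- If `P` is a prime Laurent polynomial invariant under `invert` up to units, and `P * Q` is
associated to some `f * invert f`, then `P` divides `Q`. -/
theorem LaurentPolynomial.dvd_of_associated_mul_invert {R : Type*} [CommRing R] [IsDomain R]
    {P Q f : R[T;T⁻¹]} (hP : Prime P) (hinv : Associated (invert P) P)
    (h : Associated (P * Q) (f * invert f)) : P ∣ Q := by
  have invert_dvd {g : R[T;T⁻¹]} (hg : P ∣ g) : P ∣ invert g :=
    hinv.symm.dvd.trans (map_dvd invert hg)
  have hf : P ∣ f ∧ P ∣ invert f := by
    rcases hP.dvd_or_dvd ((dvd_mul_right P Q).trans h.dvd) with hd | hd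
    · exact ⟨hd, invert_dvd hd⟩
    · exact ⟨by simpa [involutive_invert f] using invert_dvd hd, hd⟩
  exact (mul_dvd_mul_iff_left hP.ne_zero).1 ((mul_dvd_mul hf.1 hf.2).trans h.symm.dvd)

namespace TwistKnot

open Polynomial

/-- The polynomial `δ(t ^ n)`, where `δ(t) = 3 t² - 7 t + 3`. -/
noncomputable def delta (n : ℕ) : ℤ[X] := 3 * X ^ (2 * n) - 7 * X ^ n + 3

theorem toLaurent_delta (n : ℕ) :
    toLaurent (delta n) = 3 * T (2 * (n : ℤ)) - 7 * T (n : ℤ) + 3 := by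
  simp only [delta, map_add, map_sub, map_mul, map_ofNat, toLaurent_X_pow, Nat.cast_mul,
    Nat.cast_ofNat]

theorem associated_invert_delta (n : ℕ) :
    Associated (invert (toLaurent (delta n))) (toLaurent (delta n)) := by
  refine ⟨(isUnit_T (2 * (n : ℤ))).unit, ?_⟩
  rw [IsUnit.unit_spec, toLaurent_delta]
  simp only [map_add, map_sub, map_mul, map_ofNat, invert_T, add_mul, sub_mul, mul_assoc, ← T_add]
  rw [show -(2 * (n : ℤ)) + 2 * n = 0 by ring, show -(n : ℤ) + 2 * n = n by ring, T_zero]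
  ring

theorem coeff_zero_delta {n : ℕ} (hn : n ≠ 0) : (delta n).coeff 0 = 3 := by
  simp [delta, coeff_X_pow, hn, hn.symm]

theorem natDegree_delta {n : ℕ} (hn : n ≠ 0) : (delta n).natDegree = 2 * n := by
  unfold delta
  compute_degree!
  all_goals grind

theorem leadingCoeff_delta {n : ℕ} (hn : n ≠ 0) : (delta n).leadingCoeff = 3 := by
  rw [leadingCoeff, natDegree_delta hn]
  have h3 : (3 : ℤ[X]).coeff (2 * n) = 0 := coeff_C_of_ne_zero (a := (3 : ℤ)) (by lia)
  simp [delta, coeff_X_pow, hn, h3]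

theorem delta_ne_zero {n : ℕ} (hn : n ≠ 0) : delta n ≠ 0 := by
  rw [← leadingCoeff_ne_zero, leadingCoeff_delta hn]
  norm_num

/-- The roots of `δ` are not algebraic integers. -/
theorem not_isIntegral_root {x : ℂ} (hx : 3 * x ^ 2 - 7 * x + 3 = 0) : ¬ IsIntegral ℤ x := by
  intro hint
  have hmonic := minpoly.monic hint
  have hpos := minpoly.natDegree_pos hint
  obtain ⟨q, hq⟩ : minpoly ℤ x ∣ delta 1 :=
    minpoly.isIntegrallyClosed_dvd hint (by simpa [delta, map_ofNat] using hx)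
  have hq0 : q ≠ 0 := by
    rintro rfl
    exact delta_ne_zero one_ne_zero (by simpa using hq)
  have hdeg : (minpoly ℤ x).natDegree + q.natDegree = 2 := by
    rw [← natDegree_mul hmonic.ne_zero hq0, ← hq, natDegree_delta one_ne_zero, mul_one]
  rcases (by lia : (minpoly ℤ x).natDegree = 1 ∨ q.natDegree = 0) with h1 | h0
  · have heval := congrArg (eval (-(minpoly ℤ x).coeff 0)) hq
    rw [eval_mul, hmonic.eq_X_add_C h1] at heval
    generalize (minpoly ℤ x).coeff 0 = a at heval
    simp [delta] at heval
    have hodd : 3 * a ^ 2 + 7 * a + 3 = 0 := by linarith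
    rcases Int.even_or_odd' a with ⟨b, rfl | rfl⟩ <;> ring_nf at hodd <;> lia
  · rw [eq_C_of_natDegree_eq_zero h0] at hq
    have hlead := congrArg leadingCoeff hq
    have hmid := congrArg (fun r => r.coeff 1) hq
    rw [leadingCoeff_delta one_ne_zero, leadingCoeff_mul, hmonic.leadingCoeff, leadingCoeff_C,
      one_mul] at hlead
    simp [delta, coeff_X, ← hlead, coeff_X_pow] at hmid
    lia

theorem natDegree_eq_zero_of_dvd_delta {n : ℕ} {g : ℤ[X]} (hg : IsUnit g.leadingCoeff)
    (h : g ∣ delta n) : g.natDegree = 0 := by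
  by_contra hdeg
  obtain ⟨z, hz⟩ := IsAlgClosed.exists_aeval_eq_zero ℂ g
    (fun hd => hdeg (natDegree_eq_of_degree_eq_some hd))
  have hroot : aeval z (delta n) = 0 := aeval_eq_zero_of_dvd_aeval_eq_zero h hz
  have hint : IsIntegral ℤ z := by
    obtain ⟨u, hu⟩ := hg
    refine ⟨Polynomial.C (↑u⁻¹ : ℤ) * g, ?_, ?_⟩
    · rw [Monic, leadingCoeff_mul, leadingCoeff_C, ← hu, Units.inv_mul]
    · rw [← aeval_def, map_mul, hz, mul_zero]
  refine not_isIntegral_root (x := z ^ n) ?_ (hint.pow n)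
  simpa [delta, map_ofNat, ← pow_mul, mul_comm] using hroot

theorem isUnit_of_mul_eq_delta {n : ℕ} (hn : n ≠ 0) {g h : ℤ[X]} (hgh : g * h = delta n)
    (hu : IsUnit (h.coeff 0)) : IsUnit h := by
  have : Fact (Nat.Prime 3) := ⟨Nat.prime_three⟩
  let φ := Int.castRingHom (ZMod 3)
  -- Modulo 3, `h` divides a unit multiple of `X ^ n`.
  have hmap : g.map φ * h.map φ = Polynomial.C (-7) * X ^ n := by
    rw [← Polynomial.map_mul, hgh]
    have h3 : (3 : ZMod 3) = 0 := rfl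
    have h3' : (3 : (ZMod 3)[X]) = 0 := by
      rw [← map_ofNat Polynomial.C 3, h3, C_0]
    simp [delta, h3', map_ofNat]
  have hdvd : h.map φ ∣ X ^ n := by
    have h7 : (-7 : ZMod 3) ≠ 0 := of_decide_eq_true rfl
    have hc : IsUnit (Polynomial.C (-7) : (ZMod 3)[X]) := isUnit_C.2 h7.isUnit
    exact hc.dvd_mul_left.1 (Dvd.intro_left _ hmap)
  obtain ⟨i, -, hi⟩ := (dvd_prime_pow prime_X n).1 hdvd
  have hi0 : i = 0 := by
    by_contra hne
    have hX : X ∣ h.map φ := (dvd_pow_self X hne).trans hi.symm.dvd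
    rw [X_dvd_iff, coeff_map] at hX
    exact (hu.map φ).ne_zero hX
  have hunit : IsUnit (h.map φ) := by
    rw [hi0, pow_zero] at hi
    exact associated_one_iff_isUnit.1 hi
  have hlead : g.leadingCoeff * h.leadingCoeff = 3 := by
    rw [← leadingCoeff_mul, hgh, leadingCoeff_delta hn]
  have hconst : g.coeff 0 * h.coeff 0 = 3 := by
    rw [← mul_coeff_zero, hgh, coeff_zero_delta hn]
  have hdeg : h.natDegree = 0 := by
    rcases (Int.prime_three.irreducible).isUnit_or_isUnit hlead.symm with hgl | hhl
    · have hg0 := natDegree_eq_zero_of_dvd_delta hgl (Dvd.intro h hgh)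
      rw [leadingCoeff, hg0] at hgl
      have := hgl.mul hu
      rw [hconst] at this
      exact absurd this Int.prime_three.not_isUnit
    · rw [← natDegree_map_of_leadingCoeff_ne_zero φ (hhl.map φ).ne_zero]
      exact natDegree_eq_zero_of_isUnit hunit
  rw [eq_C_of_natDegree_eq_zero hdeg]
  exact isUnit_C.2 hu

theorem irreducible_delta {n : ℕ} (hn : n ≠ 0) : Irreducible (delta n) := by
  refine ⟨fun hu => ?_, fun g h hgh => ?_⟩
  · have := natDegree_eq_zero_of_isUnit hu
    rw [natDegree_delta hn] at this
    lia
  · have hconst : 3 = g.coeff 0 * h.coeff 0 := by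
      rw [← mul_coeff_zero, ← hgh, coeff_zero_delta hn]
    rcases (Int.prime_three.irreducible).isUnit_or_isUnit hconst with hu | hu
    · exact Or.inl (isUnit_of_mul_eq_delta hn (by rw [mul_comm, hgh]) hu)
    · exact Or.inr (isUnit_of_mul_eq_delta hn hgh.symm hu)

theorem not_delta_dvd_X {n : ℕ} (hn : n ≠ 0) : ¬ delta n ∣ X := fun h => by
  have := natDegree_le_of_dvd h X_ne_zero
  rw [natDegree_delta hn, natDegree_X] at this
  lia

end TwistKnot


/-- For integers `k ≥ 1` and `p ≥ 2`, there is no Laurent polynomial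
`f ∈ ℤ[T,T⁻¹]` such that `(3T^(2k) - 7T^k + 3)(3T^(2kp) - 7T^(kp) + 3)` is
associated to `f * invert f`, where `invert` sends `T` to `T⁻¹`. -/
theorem no_fox_milnor_factorization (k p : ℤ) (hk : 1 ≤ k) (hp : 2 ≤ p) :
    ¬ ∃ f : LaurentPolynomial ℤ,
      Associated
        ((3 * T (2 * k) - 7 * T k + 3) * (3 * T (2 * k * p) - 7 * T (k * p) + 3))
        (f * invert f) := by
  rintro ⟨f, hf⟩
  lift k to ℕ using by lia
  lift p to ℕ using by lia
  norm_cast at hk hp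
  have hk0 : k ≠ 0 := by lia
  have hkp0 : k * p ≠ 0 := mul_ne_zero hk0 (by lia)
  have hprime := (TwistKnot.irreducible_delta hk0).prime
  have hX := TwistKnot.not_delta_dvd_X hk0
  have hkp := TwistKnot.toLaurent_delta (k * p)
  rw [Nat.cast_mul, ← mul_assoc] at hkp
  rw [← TwistKnot.toLaurent_delta, ← hkp] at hf
  have hdvd := Polynomial.dvd_of_toLaurent_dvd hprime hX <|
    dvd_of_associated_mul_invert (Polynomial.prime_toLaurent hprime hX)
      (TwistKnot.associated_invert_delta k) hf
  have hassoc := hprime.irreducible.associated_of_dvd (TwistKnot.irreducible_delta hkp0) hdvd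
  have hdeg := Polynomial.natDegree_eq_of_degree_eq <|
    Polynomial.degree_eq_degree_of_associated hassoc
  rw [TwistKnot.natDegree_delta hk0, TwistKnot.natDegree_delta hkp0] at hdeg
  nlinarith
end
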